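/- arXiv:2005.08068 — 6 statements merged into one kernel-verified Lean document; each statement's English description precedes it below -/
import Mathlib

section
/- Let E, S be real normed vector spaces and let F : E × S → S be differentiable, with the partial derivative of F in its first argument bounded in operator norm by c ≥ 0 and the partial derivative in its second argument bounded in operator norm by K, where K > 1, at every point. Fix s₀ ∈ S and define s_0 : E → S as the constant map θ ↦ s₀ and s_{t+1}(θ) = F(θ, s_t(θ)). Then every s_t is differentiable and ‖D s_t(θ)‖ ≤ c · (K^t − 1)/(K − 1) for all θ ∈ E and t ∈ ℕ, where D denotes the Fréchet derivative and its norm is the operator norm. -/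
/-- The chain rule for `x ↦ F (x, g x)`, in terms of the partial derivatives of `F`. -/
theorem hasFDerivAt_comp_prodMk {E S G : Type*} [NormedAddCommGroup E] [NormedSpace ℝ E]
    [NormedAddCommGroup S] [NormedSpace ℝ S] [NormedAddCommGroup G] [NormedSpace ℝ G]
    {F : E × S → G} {g : E → S} {F' : E × S →L[ℝ] G} {g' : E →L[ℝ] S} {x : E}
    (hF : HasFDerivAt F F' (x, g x)) (hg : HasFDerivAt g g' x) :
    HasFDerivAt (fun y => F (y, g y))
      (F'.comp (ContinuousLinearMap.inl ℝ E S) +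
        (F'.comp (ContinuousLinearMap.inr ℝ E S)).comp g') x := by
  refine (hF.comp x ((hasFDerivAt_id x).prodMk hg)).congr_fderiv ?_
  ext v
  simp [← map_add]


theorem stmt_7
    {E S : Type*} [NormedAddCommGroup E] [NormedSpace ℝ E]
    [NormedAddCommGroup S] [NormedSpace ℝ S]
    (F : E × S → S) (hF : Differentiable ℝ F)
    (c K : ℝ) (hc : 0 ≤ c) (hK : 1 < K)
    (hF1 : ∀ p : E × S, ‖(fderiv ℝ F p).comp (ContinuousLinearMap.inl ℝ E S)‖ ≤ c)
    (hF2 : ∀ p : E × S, ‖(fderiv ℝ F p).comp (ContinuousLinearMap.inr ℝ E S)‖ ≤ K)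
    (s₀ : S) (s : ℕ → E → S)
    (hs0 : ∀ θ : E, s 0 θ = s₀)
    (hsrec : ∀ (t : ℕ) (θ : E), s (t + 1) θ = F (θ, s t θ)) :
    ∀ t : ℕ, Differentiable ℝ (s t) ∧
      ∀ θ : E, ‖fderiv ℝ (s t) θ‖ ≤ c * (K ^ t - 1) / (K - 1) := by
  have hK1 : 0 < K - 1 := sub_pos.mpr hK
  intro t
  induction t with
  | zero =>
    have h : s 0 = fun _ => s₀ := funext hs0
    simp [h]
  | succ t ih =>
    obtain ⟨hd, hb⟩ := ih
    have hderiv : ∀ θ : E, HasFDerivAt (s (t + 1))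
        ((fderiv ℝ F (θ, s t θ)).comp (ContinuousLinearMap.inl ℝ E S) +
          ((fderiv ℝ F (θ, s t θ)).comp (ContinuousLinearMap.inr ℝ E S)).comp
            (fderiv ℝ (s t) θ)) θ := by
      intro θ
      rw [show s (t + 1) = fun θ => F (θ, s t θ) from funext (hsrec t)]
      exact hasFDerivAt_comp_prodMk (hF _).hasFDerivAt (hd θ).hasFDerivAt
    refine ⟨fun θ => (hderiv θ).differentiableAt, fun θ => ?_⟩
    rw [(hderiv θ).fderiv]
    calc
      _ ≤ c + K * (c * (K ^ t - 1) / (K - 1)) := by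
        refine (norm_add_le _ _).trans (add_le_add (hF1 _) ?_)
        exact (ContinuousLinearMap.opNorm_comp_le _ _).trans
          (mul_le_mul (hF2 _) (hb θ) (norm_nonneg _) (by linarith))
      _ = c * (K ^ (t + 1) - 1) / (K - 1) := by
        field_simp
        ring
end

section
/- Let γ ∈ (0,1), K ≥ 1, L > 1 be reals with γK ≠ 1 and γKL ≠ 1, let ε_f, ε_Q, L_r, L_Q ≥ 0 be reals, and let H ∈ ℕ. Suppose e : ℕ → ℝ satisfies e 0 = 0, e t ≥ 0, and e (t+1) ≤ ε_f · K^t + L · e t for all t. Suppose ρ : ℕ → ℝ satisfies 0 ≤ ρ t ≤ L_r · e t for all t, and q is a real with 0 ≤ q ≤ ε_Q · K^H + L_Q · e H. Then ∑_{t=0}^{H−1} γ^t · ρ t + γ^H · q ≤ ε_f · c₁(H) + ε_Q · c₂(H), where c₁(H) = (L_r/(L−1)) · ( L·((γKL)^H − 1)/(γKL − 1) − ((γK)^H − 1)/(γK − 1) ) + L_Q · (γK)^H · (L^H − 1)/(L − 1) and c₂(H) = (γK)^H. -/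
theorem le_of_le_mul_pow_add_mul {K L c : ℝ} (hK : 1 ≤ K) (hL : 1 < L) (hc : 0 ≤ c)
    {e : ℕ → ℝ} (h_zero : e 0 = 0) (h_succ : ∀ t, e (t + 1) ≤ c * K ^ t + L * e t) (t : ℕ) :
    e t ≤ c * (K ^ t * ((L ^ t - 1) / (L - 1))) := by
  have hL' : 0 < L - 1 := sub_pos.2 hL
  induction t with
  | zero => simp [h_zero]
  | succ t ih =>
    have h_nonneg : 0 ≤ (L ^ (t + 1) - 1) / (L - 1) :=
      div_nonneg (sub_nonneg.2 (one_le_pow₀ hL.le)) hL'.le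
    calc e (t + 1) ≤ c * K ^ t + L * e t := h_succ t
      _ ≤ c * K ^ t + L * (c * (K ^ t * ((L ^ t - 1) / (L - 1)))) := by gcongr
      _ = c * (K ^ t * ((L ^ (t + 1) - 1) / (L - 1))) := by
        field_simp
        ring
      _ ≤ c * (K ^ (t + 1) * ((L ^ (t + 1) - 1) / (L - 1))) := by
        gcongr
        exact t.le_succ

theorem stmt_8
    (γ K L εf εQ Lr LQ : ℝ) (H : ℕ)
    (hγ : γ ∈ Set.Ioo (0 : ℝ) 1) (hK : 1 ≤ K) (hL : 1 < L)
    (hγK : γ * K ≠ 1) (hγKL : γ * K * L ≠ 1)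
    (hεf : 0 ≤ εf) (hεQ : 0 ≤ εQ) (hLr : 0 ≤ Lr) (hLQ : 0 ≤ LQ)
    (e : ℕ → ℝ) (he0 : e 0 = 0) (henn : ∀ t, 0 ≤ e t)
    (herec : ∀ t, e (t + 1) ≤ εf * K ^ t + L * e t)
    (ρ : ℕ → ℝ) (hρ : ∀ t, 0 ≤ ρ t ∧ ρ t ≤ Lr * e t)
    (q : ℝ) (hq0 : 0 ≤ q) (hq : q ≤ εQ * K ^ H + LQ * e H) :
    ∑ t ∈ Finset.range H, γ ^ t * ρ t + γ ^ H * q ≤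
      εf * ((Lr / (L - 1)) *
          (L * ((γ * K * L) ^ H - 1) / (γ * K * L - 1) -
            ((γ * K) ^ H - 1) / (γ * K - 1)) +
          LQ * (γ * K) ^ H * (L ^ H - 1) / (L - 1)) +
        εQ * (γ * K) ^ H := by
  obtain ⟨hγ0, -⟩ := hγ
  have hL' : 0 < L - 1 := sub_pos.2 hL
  have he := le_of_le_mul_pow_add_mul hK hL hεf he0 herec
  have h_term (t : ℕ) :
      γ ^ t * ρ t ≤ εf * (Lr / (L - 1)) * ((γ * K * L) ^ t - (γ * K) ^ t) := by
    calc γ ^ t * ρ t ≤ γ ^ t * (Lr * (εf * (K ^ t * ((L ^ t - 1) / (L - 1))))) := by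
          gcongr
          exact (hρ t).2.trans (by gcongr; exact he t)
      _ = _ := by
        simp only [mul_pow]
        field_simp
  have h_geom : 0 ≤ ((γ * K * L) ^ H - 1) / (γ * K * L - 1) := by
    rw [← geom_sum_eq hγKL]
    positivity
  have h_sum : ∑ t ∈ Finset.range H, γ ^ t * ρ t ≤ εf * (Lr / (L - 1)) *
      (L * ((γ * K * L) ^ H - 1) / (γ * K * L - 1) - ((γ * K) ^ H - 1) / (γ * K - 1)) := by
    refine (Finset.sum_le_sum fun t _ => h_term t).trans ?_
    rw [← Finset.mul_sum, Finset.sum_sub_distrib, geom_sum_eq hγKL, geom_sum_eq hγK, mul_div_assoc]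
    gcongr
    exact le_mul_of_one_le_left h_geom hL.le
  have h_terminal : γ ^ H * q ≤
      εf * (LQ * (γ * K) ^ H * (L ^ H - 1) / (L - 1)) + εQ * (γ * K) ^ H := by
    calc γ ^ H * q
        ≤ γ ^ H * (εQ * K ^ H + LQ * (εf * (K ^ H * ((L ^ H - 1) / (L - 1))))) := by
          gcongr
          exact hq.trans (by gcongr; exact he H)
      _ = _ := by
        rw [mul_pow]
        ring
  linarith
end

section
/- Let γ ∈ (0,1), K ≥ 1, L > 1 with γK ≠ 1 and γKL ≠ 1, let ε_f, L_r ≥ 0, and let H ∈ ℕ. Suppose e : ℕ → ℝ satisfies e 0 = 0, e t ≥ 0, and e (t+1) ≤ ε_f · K^t + L · e t for all t, and suppose ρ : ℕ → ℝ satisfies 0 ≤ ρ t ≤ L_r · e t for all t. Then ∑_{t=0}^{H−1} γ^t · ρ t ≤ (ε_f · L_r/(L−1)) · ( L·((γKL)^H − 1)/(γKL − 1) − ((γK)^H − 1)/(γK − 1) ). -/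
/-- A sequence starting at `0` with `e (t + 1) ≤ ε K ^ t + L e t` grows at most like
`ε K ^ t (1 + L + ⋯ + L ^ t)`. -/
theorem le_mul_geom_of_le_mul_pow_add_mul {K L ε : ℝ} (hK : 1 ≤ K) (hL : 1 < L) (hε : 0 ≤ ε)
    {e : ℕ → ℝ} (he0 : e 0 = 0) (herec : ∀ t, e (t + 1) ≤ ε * K ^ t + L * e t) (t : ℕ) :
    e t ≤ ε * K ^ t * ((L ^ (t + 1) - 1) / (L - 1)) := by
  have hL1 : 0 < L - 1 := sub_pos.mpr hL
  have hquot (n : ℕ) : 0 ≤ (L ^ n - 1) / (L - 1) :=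
    div_nonneg (sub_nonneg.mpr (one_le_pow₀ hL.le)) hL1.le
  induction t with
  | zero => simpa [he0] using mul_nonneg hε (hquot 1)
  | succ t ih =>
    calc e (t + 1) ≤ ε * K ^ t + L * e t := herec t
      _ ≤ ε * K ^ t + L * (ε * K ^ t * ((L ^ (t + 1) - 1) / (L - 1))) := by gcongr
      _ = ε * K ^ t * ((L ^ (t + 1 + 1) - 1) / (L - 1)) := by
        field_simp
        ring
      _ ≤ ε * K ^ (t + 1) * ((L ^ (t + 1 + 1) - 1) / (L - 1)) := by
        have := hquot (t + 1 + 1)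
        gcongr
        exact t.le_succ

theorem stmt_9
    (γ K L εf Lr : ℝ) (H : ℕ)
    (hγ : γ ∈ Set.Ioo (0 : ℝ) 1) (hK : 1 ≤ K) (hL : 1 < L)
    (hγK : γ * K ≠ 1) (hγKL : γ * K * L ≠ 1)
    (hεf : 0 ≤ εf) (hLr : 0 ≤ Lr)
    (e : ℕ → ℝ) (he0 : e 0 = 0) (henn : ∀ t, 0 ≤ e t)
    (herec : ∀ t, e (t + 1) ≤ εf * K ^ t + L * e t)
    (ρ : ℕ → ℝ) (hρ : ∀ t, 0 ≤ ρ t ∧ ρ t ≤ Lr * e t) :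
    ∑ t ∈ Finset.range H, γ ^ t * ρ t ≤
      (εf * Lr / (L - 1)) *
        (L * ((γ * K * L) ^ H - 1) / (γ * K * L - 1) -
          ((γ * K) ^ H - 1) / (γ * K - 1)) := by
  have hγ0 : 0 ≤ γ := hγ.1.le
  have hL1 : L - 1 ≠ 0 := (sub_pos.mpr hL).ne'
  calc ∑ t ∈ Finset.range H, γ ^ t * ρ t
      ≤ ∑ t ∈ Finset.range H, γ ^ t * (Lr * (εf * K ^ t * ((L ^ (t + 1) - 1) / (L - 1)))) := by
        refine Finset.sum_le_sum fun t _ => mul_le_mul_of_nonneg_left ?_ (pow_nonneg hγ0 t)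
        exact (hρ t).2.trans (mul_le_mul_of_nonneg_left
          (le_mul_geom_of_le_mul_pow_add_mul hK hL hεf he0 herec t) hLr)
    _ = ∑ t ∈ Finset.range H,
          (εf * Lr / (L - 1)) * (L * (γ * K * L) ^ t - (γ * K) ^ t) := by
        refine Finset.sum_congr rfl fun t _ => ?_
        rw [mul_pow, mul_pow]
        field_simp
        ring
    _ = _ := by
        rw [← Finset.mul_sum, Finset.sum_sub_distrib, ← Finset.mul_sum, geom_sum_eq hγKL,
          geom_sum_eq hγK, mul_div_assoc L]
end

section
/- Let μ₁, μ₂ ∈ ℝ and σ > 0. Then for every measurable set A ⊆ ℝ, the Gaussian measures on ℝ with means μ₁, μ₂ and common variance σ² satisfy |N(μ₁,σ²)(A) − N(μ₂,σ²)(A)| ≤ |μ₁ − μ₂| / (2σ); that is, their total variation distance is at most |μ₁ − μ₂|/(2σ). -/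
open MeasureTheory ProbabilityTheory

open scoped NNReal

lemma gaussianPDFReal_le (μ : ℝ) (v : ℝ≥0) (x : ℝ) :
    gaussianPDFReal μ v x ≤ (√(2 * Real.pi * v))⁻¹ := by
  rw [gaussianPDFReal]
  refine mul_le_of_le_one_right (by positivity) (Real.exp_le_one_iff.2 ?_)
  rw [neg_div]
  exact neg_nonpos.2 (by positivity)

lemma gaussianReal_real_eq_integral (μ : ℝ) {v : ℝ≥0} (hv : v ≠ 0) (s : Set ℝ) :
    (gaussianReal μ v).real s = ∫ x in s, gaussianPDFReal μ v x := by
  rw [measureReal_def, gaussianReal_apply_eq_integral μ hv s,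
    ENNReal.toReal_ofReal (integral_nonneg fun x ↦ gaussianPDFReal_nonneg μ v x)]

lemma gaussianReal_real_Ioc_le (μ : ℝ) {v : ℝ≥0} (hv : v ≠ 0) {a b : ℝ} (hab : a ≤ b) :
    (gaussianReal μ v).real (Set.Ioc a b) ≤ (b - a) / √(2 * Real.pi * v) := by
  rw [gaussianReal_real_eq_integral μ hv]
  calc ∫ x in Set.Ioc a b, gaussianPDFReal μ v x
      ≤ ∫ _ in Set.Ioc a b, (√(2 * Real.pi * v))⁻¹ :=
        setIntegral_mono (integrable_gaussianPDFReal μ v).integrableOn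
          (integrableOn_const (by simp))
          (gaussianPDFReal_le μ v)
    _ = (b - a) / √(2 * Real.pi * v) := by
        simp [hab, div_eq_mul_inv]

/-- The sign of the difference of two Gaussian densities of equal variance changes at the midpoint
of their means. -/
lemma gaussianPDFReal_le_gaussianPDFReal_iff {μ₁ μ₂ : ℝ} (h : μ₁ < μ₂) {v : ℝ≥0} (hv : v ≠ 0)
    (x : ℝ) : gaussianPDFReal μ₂ v x ≤ gaussianPDFReal μ₁ v x ↔ x ≤ (μ₁ + μ₂) / 2 := by
  have hv' : (0 : ℝ) < v := by positivity
  rw [gaussianPDFReal, gaussianPDFReal, mul_le_mul_iff_right₀ (by positivity), Real.exp_le_exp,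
    div_le_div_iff_of_pos_right (by positivity)]
  constructor <;> intro _ <;> nlinarith

lemma gaussianReal_real_sub_le_of_lt {μ₁ μ₂ : ℝ} (h : μ₁ < μ₂) {v : ℝ≥0} (hv : v ≠ 0)
    {A : Set ℝ} (hA : MeasurableSet A) :
    (gaussianReal μ₁ v).real A - (gaussianReal μ₂ v).real A ≤
      (μ₂ - μ₁) / √(2 * Real.pi * v) := by
  set m := (μ₁ + μ₂) / 2
  have h_diff (s : Set ℝ) : (gaussianReal μ₁ v).real s - (gaussianReal μ₂ v).real s =
      ∫ x in s, (gaussianPDFReal μ₁ v x - gaussianPDFReal μ₂ v x) := by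
    rw [gaussianReal_real_eq_integral μ₁ hv, gaussianReal_real_eq_integral μ₂ hv,
      integral_sub (integrable_gaussianPDFReal μ₁ v).integrableOn
        (integrable_gaussianPDFReal μ₂ v).integrableOn]
  have h_set : {x | 0 ≤ gaussianPDFReal μ₁ v x - gaussianPDFReal μ₂ v x} = Set.Iic m := by
    ext x
    simpa using gaussianPDFReal_le_gaussianPDFReal_iff h hv x
  have h_shift : (gaussianReal μ₂ v).real (Set.Iic m) =
      (gaussianReal μ₁ v).real (Set.Iic (m - (μ₂ - μ₁))) := by
    have h_map := gaussianReal_map_add_const (μ := μ₁) (v := v) (μ₂ - μ₁)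
    rw [add_sub_cancel] at h_map
    rw [← h_map, map_measureReal_apply (by fun_prop) measurableSet_Iic]
    simp
  calc (gaussianReal μ₁ v).real A - (gaussianReal μ₂ v).real A
      ≤ (gaussianReal μ₁ v).real (Set.Iic m) - (gaussianReal μ₂ v).real (Set.Iic m) := by
        rw [h_diff, h_diff, ← h_set]
        exact setIntegral_le_nonneg hA
          ((stronglyMeasurable_gaussianPDFReal μ₁ v).sub (stronglyMeasurable_gaussianPDFReal μ₂ v))
          ((integrable_gaussianPDFReal μ₁ v).sub (integrable_gaussianPDFReal μ₂ v))
    _ = (gaussianReal μ₁ v).real (Set.Ioc (m - (μ₂ - μ₁)) m) := by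
        rw [h_shift, ← measureReal_sdiff (Set.Iic_subset_Iic.2 (by linarith)) measurableSet_Iic,
          Set.Iic_sdiff_Iic]
    _ ≤ (μ₂ - μ₁) / √(2 * Real.pi * v) := by
        simpa using gaussianReal_real_Ioc_le μ₁ hv (a := m - (μ₂ - μ₁)) (b := m) (by linarith)

lemma abs_gaussianReal_real_sub_le (μ₁ μ₂ : ℝ) {v : ℝ≥0} (hv : v ≠ 0)
    {A : Set ℝ} (hA : MeasurableSet A) :
    |(gaussianReal μ₁ v).real A - (gaussianReal μ₂ v).real A| ≤
      |μ₁ - μ₂| / √(2 * Real.pi * v) := by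
  wlog h : μ₁ < μ₂ generalizing μ₁ μ₂
  · rcases (not_lt.1 h).eq_or_lt with rfl | h
    · simp
    · rw [abs_sub_comm, abs_sub_comm μ₁]
      exact this μ₂ μ₁ h
  rw [abs_sub_comm μ₁, abs_of_pos (sub_pos.2 h), abs_sub_le_iff]
  refine ⟨gaussianReal_real_sub_le_of_lt h hv hA, ?_⟩
  have h_compl := gaussianReal_real_sub_le_of_lt h hv hA.compl
  rw [probReal_compl_eq_one_sub hA, probReal_compl_eq_one_sub hA] at h_compl
  linarith

theorem stmt_13 (μ₁ μ₂ σ : ℝ) (hσ : 0 < σ) :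
    ∀ A : Set ℝ, MeasurableSet A →
      |(gaussianReal μ₁ ⟨σ ^ 2, sq_nonneg σ⟩ A).toReal -
          (gaussianReal μ₂ ⟨σ ^ 2, sq_nonneg σ⟩ A).toReal| ≤
        |μ₁ - μ₂| / (2 * σ) := by
  intro A hA
  have hv : (⟨σ ^ 2, sq_nonneg σ⟩ : ℝ≥0) ≠ 0 := fun h ↦
    (pow_pos hσ 2).ne' (congrArg NNReal.toReal h)
  refine (abs_gaussianReal_real_sub_le μ₁ μ₂ hv hA).trans ?_
  refine div_le_div_of_nonneg_left (abs_nonneg _) (by positivity) (Real.le_sqrt_of_sq_le ?_)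
  change (2 * σ) ^ 2 ≤ 2 * Real.pi * σ ^ 2
  nlinarith [Real.pi_gt_three, pow_pos hσ 2]
end

section
/- Let S be a nonempty finite type, let P, Q : S → S → ℝ be row-stochastic (entries nonnegative with each row summing to 1), and let μ : S → ℝ be a probability vector (μ s ≥ 0, ∑_s μ s = 1). Define (vP)(s') = ∑_s v s · P s s' and let P^t denote the t-fold matrix power. Then for every t ∈ ℕ, ∑_{s'} |(μP^t)(s') − (μQ^t)(s')| ≤ t · max_{s} ∑_{s'} |P s s' − Q s s'|. -/
open Finset

/-- If every row of `M` has `ℓ¹` norm at most `c`, then `v ↦ v ᵥ* M` scales the `ℓ¹` norm by at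
most `c`. -/
theorem sum_abs_vecMul_le {m n : Type*} [Fintype m] [Fintype n] (v : m → ℝ) (M : Matrix m n ℝ)
    {c : ℝ} (hM : ∀ i, ∑ j, |M i j| ≤ c) :
    ∑ j, |Matrix.vecMul v M j| ≤ c * ∑ i, |v i| :=
  calc ∑ j, |Matrix.vecMul v M j|
      ≤ ∑ j, ∑ i, |v i| * |M i j| := by
        refine sum_le_sum fun j _ => ?_
        simp only [Matrix.vecMul, dotProduct, ← abs_mul]
        exact abs_sum_le_sum_abs _ _
    _ = ∑ i, |v i| * ∑ j, |M i j| := by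
        rw [sum_comm]
        simp only [mul_sum]
    _ ≤ ∑ i, |v i| * c :=
        sum_le_sum fun i _ => mul_le_mul_of_nonneg_left (hM i) (abs_nonneg _)
    _ = c * ∑ i, |v i| := by rw [← sum_mul, mul_comm]

theorem sum_abs_vecMul_pow_le {n : Type*} [Fintype n] [DecidableEq n] (v : n → ℝ)
    {M : Matrix n n ℝ} (hM : ∀ i, ∑ j, |M i j| ≤ 1) (t : ℕ) :
    ∑ j, |Matrix.vecMul v (M ^ t) j| ≤ ∑ i, |v i| := by
  induction t with
  | zero => simp
  | succ t ih =>
    rw [pow_succ, ← Matrix.vecMul_vecMul]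
    exact (sum_abs_vecMul_le _ M hM).trans (by rwa [one_mul])

theorem stmt_15
    {S : Type*} [Fintype S] [DecidableEq S] [Nonempty S]
    (P Q : Matrix S S ℝ)
    (hPnn : ∀ s s', 0 ≤ P s s') (hProw : ∀ s, ∑ s', P s s' = 1)
    (hQnn : ∀ s s', 0 ≤ Q s s') (hQrow : ∀ s, ∑ s', Q s s' = 1)
    (μ : S → ℝ) (hμnn : ∀ s, 0 ≤ μ s) (hμsum : ∑ s, μ s = 1) :
    ∀ t : ℕ,
      ∑ s', |Matrix.vecMul μ (P ^ t) s' - Matrix.vecMul μ (Q ^ t) s'| ≤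
        (t : ℝ) * (univ.sup' univ_nonempty fun s => ∑ s', |P s s' - Q s s'|) := by
  have hP : ∀ s, ∑ s', |P s s'| ≤ 1 := fun s => by
    simp only [abs_of_nonneg (hPnn s _), hProw s, le_refl]
  have hQ : ∀ s, ∑ s', |Q s s'| ≤ 1 := fun s => by
    simp only [abs_of_nonneg (hQnn s _), hQrow s, le_refl]
  have hμ : ∑ s, |μ s| = 1 := by simp only [abs_of_nonneg (hμnn _), hμsum]
  set D := univ.sup' univ_nonempty fun s => ∑ s', |P s s' - Q s s'|
  have hPQ : ∀ s, ∑ s', |(P - Q) s s'| ≤ D := fun s =>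
    le_sup' (fun s => ∑ s', |P s s' - Q s s'|) (mem_univ s)
  have hD0 : 0 ≤ D :=
    (sum_nonneg fun _ _ => abs_nonneg _).trans (hPQ (Classical.arbitrary S))
  intro t
  induction t with
  | zero => simp
  | succ t ih =>
    have decomp : Matrix.vecMul μ (P ^ (t + 1)) - Matrix.vecMul μ (Q ^ (t + 1)) =
        Matrix.vecMul (Matrix.vecMul μ (P ^ t) - Matrix.vecMul μ (Q ^ t)) P +
          Matrix.vecMul (Matrix.vecMul μ (Q ^ t)) (P - Q) := by
      rw [Matrix.sub_vecMul, Matrix.vecMul_sub, pow_succ, pow_succ]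
      simp only [Matrix.vecMul_vecMul]
      abel
    have drift := sum_abs_vecMul_le (Matrix.vecMul μ (P ^ t) - Matrix.vecMul μ (Q ^ t)) P hP
    have step := sum_abs_vecMul_le (Matrix.vecMul μ (Q ^ t)) (P - Q) hPQ
    have mass := mul_le_mul_of_nonneg_left (sum_abs_vecMul_pow_le μ hQ t) hD0
    rw [hμ] at mass
    simp only [one_mul, Pi.sub_apply] at drift
    simp only [← Pi.sub_apply (Matrix.vecMul μ (P ^ (t + 1))), decomp, Pi.add_apply]
    refine (sum_le_sum fun _ _ => abs_add_le _ _).trans ?_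
    rw [sum_add_distrib]
    push_cast
    linarith
end

section
/- Let S and A be nonempty finite types, let ρ, ρ̂ : S → ℝ be probability vectors, and let π, π̂ : S → A → ℝ be such that for every s, π s and π̂ s are probability vectors on A. Then ∑_{s} ∑_{a} | ρ s · π s a − ρ̂ s · π̂ s a | ≤ ∑_{s} |ρ s − ρ̂ s| + max_{s} ∑_{a} |π s a − π̂ s a|. -/
open Finset

theorem stmt_18
    {S A : Type*} [Fintype S] [Nonempty S] [Fintype A] [Nonempty A]
    (ρ ρhat : S → ℝ)
    (hρnn : ∀ s, 0 ≤ ρ s) (hρsum : ∑ s, ρ s = 1)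
    (hρhatnn : ∀ s, 0 ≤ ρhat s) (hρhatsum : ∑ s, ρhat s = 1)
    (π πhat : S → A → ℝ)
    (hπnn : ∀ s a, 0 ≤ π s a) (hπsum : ∀ s, ∑ a, π s a = 1)
    (hπhatnn : ∀ s a, 0 ≤ πhat s a) (hπhatsum : ∀ s, ∑ a, πhat s a = 1) :
    ∑ s, ∑ a, |ρ s * π s a - ρhat s * πhat s a| ≤
      (∑ s, |ρ s - ρhat s|) +
        univ.sup' univ_nonempty (fun s => ∑ a, |π s a - πhat s a|) := by
  set M := univ.sup' univ_nonempty (fun s => ∑ a, |π s a - πhat s a|)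
  have hle (s : S) : ∑ a, |π s a - πhat s a| ≤ M :=
    le_sup' (fun s => ∑ a, |π s a - πhat s a|) (mem_univ s)
  have hstate (s : S) : ∑ a, |ρ s * π s a - ρhat s * πhat s a| ≤
      |ρ s - ρhat s| + ρhat s * M := by
    calc ∑ a, |ρ s * π s a - ρhat s * πhat s a|
        ≤ ∑ a, (|ρ s - ρhat s| * π s a + ρhat s * |π s a - πhat s a|) := by
          refine sum_le_sum fun a _ => ?_
          calc |ρ s * π s a - ρhat s * πhat s a|
              = |(ρ s - ρhat s) * π s a + ρhat s * (π s a - πhat s a)| := by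
                congr 1
                ring
            _ ≤ |(ρ s - ρhat s) * π s a| + |ρhat s * (π s a - πhat s a)| := abs_add_le _ _
            _ = |ρ s - ρhat s| * π s a + ρhat s * |π s a - πhat s a| := by
                rw [abs_mul, abs_mul, abs_of_nonneg (hπnn s a), abs_of_nonneg (hρhatnn s)]
      _ = |ρ s - ρhat s| + ρhat s * ∑ a, |π s a - πhat s a| := by
          rw [sum_add_distrib, ← mul_sum, ← mul_sum, hπsum, mul_one]
      _ ≤ |ρ s - ρhat s| + ρhat s * M := by
          gcongr
          · exact hρhatnn s
          · exact hle s
  calc ∑ s, ∑ a, |ρ s * π s a - ρhat s * πhat s a|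
      ≤ ∑ s, (|ρ s - ρhat s| + ρhat s * M) := sum_le_sum fun s _ => hstate s
    _ = ∑ s, |ρ s - ρhat s| + M := by
        rw [sum_add_distrib, ← sum_mul, hρhatsum, one_mul]
end
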